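/- arXiv:0807.0599 — 2 statements merged into one kernel-verified Lean document; each statement's English description precedes it below -/
import Mathlib

section
/- Let H be a semisimple Hopf algebra over an algebraically closed field of characteristic zero and K a Hopf subalgebra whose two-sided integral Λ_K is central in H. Then K is a normal Hopf subalgebra: a_{(1)} K S(a_{(2)}) ⊆ K for all a ∈ H. -/
open TensorProduct Coalgebra HopfAlgebra

namespace HopfAlgebra

open LinearMap WithConv

variable {k H : Type*} [Field k] [Ring H] [HopfAlgebra k H]

/-- The left slice map `u ⊗ v ↦ g(u) v`. -/
noncomputable def leftSlice (g : H →ₗ[k] k) : H ⊗[k] H →ₗ[k] H :=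
  (TensorProduct.lid k H).toLinearMap ∘ₗ g.rTensor H

@[simp]
lemma leftSlice_tmul (g : H →ₗ[k] k) (u v : H) : leftSlice g (u ⊗ₜ[k] v) = g u • v := by
  simp [leftSlice]

lemma includeLeft_convMul_includeRight :
    toConv (Algebra.TensorProduct.includeLeft : H →ₐ[k] H ⊗[k] H).toLinearMap *
      toConv (Algebra.TensorProduct.includeRight : H →ₐ[k] H ⊗[k] H).toLinearMap =
      toConv (comul (R := k) (A := H)) := by
  ext a
  simp [(ℛ k a).convMul_apply, (ℛ k a).eq]

lemma algHom_convMul_antipode {A : Type*} [Ring A] [Algebra k A] (f : H →ₐ[k] A) :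
    toConv f.toLinearMap * toConv (f.toLinearMap ∘ₗ antipode k) = 1 := by
  have h := algHom_comp_convMul_distrib f (toConv (LinearMap.id : H →ₗ[k] H))
    (toConv (antipode k))
  rw [id_mul_antipode] at h
  apply WithConv.ext
  rw [LinearMap.comp_id] at h
  rw [← h]
  ext; simp

lemma algHom_antipode_convMul {A : Type*} [Ring A] [Algebra k A] (f : H →ₐ[k] A) :
    toConv (f.toLinearMap ∘ₗ antipode k) * toConv f.toLinearMap = 1 := by
  have h := algHom_comp_convMul_distrib f (toConv (antipode k))
    (toConv (LinearMap.id : H →ₗ[k] H))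
  rw [antipode_mul_id] at h
  apply WithConv.ext
  rw [LinearMap.comp_id] at h
  rw [← h]
  ext; simp

/-- The identity `∑ (S(a₍₁₎) ⊗ 1) Δ(a₍₂₎) = 1 ⊗ a`. -/
lemma includeLeft_antipode_convMul_comul :
    toConv ((Algebra.TensorProduct.includeLeft : H →ₐ[k] H ⊗[k] H).toLinearMap ∘ₗ antipode k) *
      toConv (comul (R := k) (A := H)) =
      toConv (Algebra.TensorProduct.includeRight : H →ₐ[k] H ⊗[k] H).toLinearMap := by
  rw [← includeLeft_convMul_includeRight, ← mul_assoc, algHom_antipode_convMul, one_mul]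

/-- The identity `∑ Δ(a₍₁₎) (x ⊗ 1) Δ(S(a₍₂₎)) = ∑ a₍₁₎ x S(a₍₂₎) ⊗ 1`. -/
lemma comul_mulRight_convMul_comul_antipode (x : H) :
    toConv (LinearMap.mulRight k (x ⊗ₜ[k] (1 : H)) ∘ₗ comul (R := k) (A := H)) *
      toConv (comul (R := k) (A := H) ∘ₗ antipode k) =
    toConv (LinearMap.mulRight k (x ⊗ₜ[k] (1 : H)) ∘ₗ
        (Algebra.TensorProduct.includeLeft : H →ₐ[k] H ⊗[k] H).toLinearMap) *
      toConv ((Algebra.TensorProduct.includeLeft : H →ₐ[k] H ⊗[k] H).toLinearMap ∘ₗ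
        antipode k) := by
  have h1 : toConv (LinearMap.mulRight k (x ⊗ₜ[k] (1 : H)) ∘ₗ comul (R := k) (A := H)) =
      toConv (LinearMap.mulRight k (x ⊗ₜ[k] (1 : H)) ∘ₗ
        (Algebra.TensorProduct.includeLeft : H →ₐ[k] H ⊗[k] H).toLinearMap) *
      toConv (Algebra.TensorProduct.includeRight : H →ₐ[k] H ⊗[k] H).toLinearMap := by
    ext a
    rw [(ℛ k a).convMul_apply]
    simp only [LinearMap.comp_apply, ← (ℛ k a).eq]
    simp
  have h2 : toConv (comul (R := k) (A := H)) *
      toConv (comul (R := k) (A := H) ∘ₗ antipode k) = 1 :=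
    algHom_convMul_antipode (Bialgebra.comulAlgHom k H)
  rw [h1, ← includeLeft_antipode_convMul_comul, mul_assoc, mul_assoc, h2, mul_one]

/-- `c` is coinvariant relative to `Λ` when `c₍₁₎ ⊗ c₍₂₎ Λ = c ⊗ Λ`. -/
def IsCoinvariant (k : Type*) {H : Type*} [Field k] [Ring H] [HopfAlgebra k H] (Λ c : H) : Prop :=
  comul (R := k) c * ((1 : H) ⊗ₜ[k] Λ) = c ⊗ₜ[k] Λ

lemma IsCoinvariant.mul {Λ b c : H} (hb : IsCoinvariant k Λ b) (hc : IsCoinvariant k Λ c) :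
    IsCoinvariant k Λ (b * c) := by
  have hcom : c ⊗ₜ[k] Λ = ((1 : H) ⊗ₜ[k] Λ) * (c ⊗ₜ[k] (1 : H)) := by simp
  rw [IsCoinvariant, Bialgebra.comul_mul, mul_assoc, hc, hcom, ← mul_assoc, hb]
  simp

lemma isCoinvariant_adjoint {Λ x : H} (hΛ : ∀ a : H, a * Λ = Λ * a)
    (hx : IsCoinvariant k Λ x) (a : H) :
    IsCoinvariant k Λ (LinearMap.mul' k H
      ((TensorProduct.map (LinearMap.mulRight k x) (antipode (R := k))) (comul (R := k) a))) := by
  have hcom (z : H ⊗[k] H) : z * ((1 : H) ⊗ₜ[k] Λ) = ((1 : H) ⊗ₜ[k] Λ) * z := by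
    induction z with
    | zero => simp
    | tmul u v => simp [hΛ]
    | add u v hu hv => rw [add_mul, mul_add, hu, hv]
  have h := congr($(comul_mulRight_convMul_comul_antipode (k := k) x) a)
  rw [(ℛ k a).convMul_apply, (ℛ k a).convMul_apply] at h
  have h' := congr($h * ((1 : H) ⊗ₜ[k] Λ))
  rw [IsCoinvariant, ← (ℛ k a).eq]
  simp only [map_sum, TensorProduct.map_tmul, LinearMap.mul'_apply, LinearMap.mulRight_apply,
    Bialgebra.comul_mul, Finset.sum_mul, TensorProduct.sum_tmul]
  simp only [LinearMap.comp_apply, LinearMap.mulRight_apply, Finset.sum_mul] at h'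
  convert h' using 2 with i _ i _
  · rw [mul_assoc, mul_assoc, mul_assoc, hcom, mul_assoc, ← mul_assoc (comul x), hx,
      ← mul_assoc (x ⊗ₜ[k] (1 : H))]
    simp
  · simp

/-- If `c₍₁₎ ⊗ c₍₂₎ Λ = c ⊗ Λ` then `Λ₍₁₎ ⊗ c Λ₍₂₎ = S(c) Λ₍₁₎ ⊗ Λ₍₂₎`. -/
lemma IsCoinvariant.tmul_mul_comul {Λ c : H} (hc : IsCoinvariant k Λ c) :
    ((1 : H) ⊗ₜ[k] c) * comul (R := k) Λ =
      (antipode k c ⊗ₜ[k] (1 : H)) * comul (R := k) Λ := by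
  let φ : H ⊗[k] H →ₗ[k] H ⊗[k] H := LinearMap.mul' k (H ⊗[k] H) ∘ₗ TensorProduct.map
    ((Algebra.TensorProduct.includeLeft : H →ₐ[k] H ⊗[k] H).toLinearMap ∘ₗ antipode k) comul
  have hφ (z : H ⊗[k] H) : φ (z * ((1 : H) ⊗ₜ[k] Λ)) = φ z * comul (R := k) Λ := by
    induction z with
    | zero => simp
    | tmul u v => simp [φ, mul_assoc]
    | add u v hu hv => rw [add_mul, map_add, hu, hv, map_add, add_mul]
  have h1 : φ (comul c) = (1 : H) ⊗ₜ[k] c :=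
    congr($(includeLeft_antipode_convMul_comul (k := k)) c)
  rw [← h1, ← hφ, hc]
  simp [φ]

lemma IsCoinvariant.mul_leftSlice {Λ c : H} (hc : IsCoinvariant k Λ c) (g : H →ₗ[k] k) :
    c * leftSlice g (comul Λ) = leftSlice (g ∘ₗ LinearMap.mulLeft k (antipode k c)) (comul Λ) := by
  have h1 (z : H ⊗[k] H) : c * leftSlice g z = leftSlice g (((1 : H) ⊗ₜ[k] c) * z) := by
    induction z with
    | zero => simp
    | tmul u v => simp
    | add u v hu hv => simp only [mul_add, map_add, hu, hv]
  have h2 (z : H ⊗[k] H) : leftSlice (g ∘ₗ LinearMap.mulLeft k (antipode k c)) z =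
      leftSlice g ((antipode k c ⊗ₜ[k] (1 : H)) * z) := by
    induction z with
    | zero => simp
    | tmul u v => simp
    | add u v hu hv => simp only [mul_add, map_add, hu, hv]
  rw [h1, h2, hc.tmul_mul_comul]

lemma leftSlice_comul_leftSlice_comul (e g : H →ₗ[k] k) (c : H) :
    leftSlice e (comul (leftSlice g (comul c))) =
      leftSlice (LinearMap.mul' k k ∘ₗ TensorProduct.map g e ∘ₗ comul) (comul c) := by
  have h1 (z : H ⊗[k] H) : comul (R := k) (leftSlice g z) =
      TensorProduct.lid k (H ⊗[k] H) (g.rTensor (H ⊗[k] H) (comul.lTensor H z)) := by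
    induction z with
    | zero => simp
    | tmul u v => simp
    | add u v hu hv => simp only [map_add, hu, hv]
  have h2 : leftSlice e ∘ₗ (TensorProduct.lid k (H ⊗[k] H)).toLinearMap ∘ₗ
      g.rTensor (H ⊗[k] H) ∘ₗ (TensorProduct.assoc k H H H).toLinearMap =
      (TensorProduct.lid k H).toLinearMap ∘ₗ
        (LinearMap.mul' k k ∘ₗ TensorProduct.map g e).rTensor H := by
    ext u v w
    simp [mul_smul]
  rw [h1, ← coassoc_apply]
  refine congr($h2 (comul.rTensor H (comul c))).trans ?_
  simp only [leftSlice, LinearMap.comp_apply, ← LinearMap.rTensor_comp_apply,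
    LinearMap.comp_assoc]

lemma sum_basis_tmul_leftSlice {ι : Type*} [Fintype ι] (e : Module.Basis ι k H)
    (z : H ⊗[k] H) : ∑ i, e i ⊗ₜ[k] leftSlice (e.coord i) z = z := by
  induction z with
  | zero => simp
  | tmul u v =>
    simp only [leftSlice_tmul, ← TensorProduct.smul_tmul, ← TensorProduct.sum_tmul]
    simp [e.sum_repr]
  | add u v hu hv => simp only [map_add, TensorProduct.tmul_add, Finset.sum_add_distrib, hu, hv]

section HopfSubalgebra

variable {K : Subalgebra k H}

lemma leftSlice_comul_mem
    (hΔ : ∀ x ∈ K, comul (R := k) x ∈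
      LinearMap.range (TensorProduct.map K.val.toLinearMap K.val.toLinearMap))
    {c : H} (hc : c ∈ K) (g : H →ₗ[k] k) :
    leftSlice g (comul c) ∈ K := by
  obtain ⟨t, ht⟩ := hΔ c hc
  rw [← ht]
  clear ht
  induction t with
  | zero => simp
  | tmul u v => simpa using K.smul_mem v.2 _
  | add u v hu hv => simpa only [map_add] using K.add_mem hu hv

lemma isCoinvariant_of_mem
    (hΔ : ∀ x ∈ K, comul (R := k) x ∈
      LinearMap.range (TensorProduct.map K.val.toLinearMap K.val.toLinearMap))
    {Λ : H} (hΛ : ∀ x ∈ K, x * Λ = (counit (R := k) x : k) • Λ)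
    {c : H} (hc : c ∈ K) : IsCoinvariant k Λ c := by
  obtain ⟨t, ht⟩ := hΔ c hc
  have key : TensorProduct.map K.val.toLinearMap K.val.toLinearMap t * ((1 : H) ⊗ₜ[k] Λ) =
      TensorProduct.rid k H (counit.lTensor H
        (TensorProduct.map K.val.toLinearMap K.val.toLinearMap t)) ⊗ₜ[k] Λ := by
    clear ht
    induction t with
    | zero => simp
    | tmul u v => simp [hΛ v v.2, TensorProduct.smul_tmul]
    | add u v hu hv => simp only [map_add, add_mul, hu, hv, TensorProduct.add_tmul]
  rw [ht] at key
  rw [IsCoinvariant, key]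
  simp

/-- An element coinvariant relative to a left integral of a Hopf subalgebra lies in it. -/
lemma mem_of_isCoinvariant [FiniteDimensional k H]
    (hΔ : ∀ x ∈ K, comul (R := k) x ∈
      LinearMap.range (TensorProduct.map K.val.toLinearMap K.val.toLinearMap))
    (hSK : ∀ x ∈ K, antipode (R := k) x ∈ K)
    {Λ : H} (hΛK : Λ ∈ K) (hΛ0 : Λ ≠ 0)
    (hΛ : ∀ x ∈ K, x * Λ = (counit (R := k) x : k) • Λ) {b : H} (hb : IsCoinvariant k Λ b) :
    b ∈ K := by
  obtain ⟨F, hF⟩ : ∃ F : H →ₗ[k] k, F Λ ≠ 0 := by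
    by_contra! h
    exact hΛ0 ((Module.forall_dual_apply_eq_zero_iff k Λ).1 h)
  obtain ⟨P, hP⟩ := K.val.toLinearMap.exists_leftInverse_of_injective
    (LinearMap.ker_eq_bot.2 Subtype.val_injective)
  have hPK (u : K) : P u = u := congr($hP u)
  have hwK : leftSlice F (comul Λ) ∈ K := leftSlice_comul_mem hΔ hΛK F
  set w := leftSlice F (comul Λ) with hw
  let ψ : H ⊗[k] H →ₗ[k] H := LinearMap.mul' k H ∘ₗ
    (antipode k ∘ₗ K.val.toLinearMap ∘ₗ P).rTensor H
  have hψ : ψ (comul w) = algebraMap k H (F Λ) := by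
    have h1 : ψ (comul w) = LinearMap.mul' k H ((antipode k).rTensor H (comul w)) := by
      obtain ⟨t, ht⟩ := hΔ w hwK
      rw [← ht]
      clear ht
      induction t with
      | zero => simp
      | tmul u v => simp [ψ, hPK]
      | add u v hu hv => simp only [map_add, hu, hv]
    have h2 (z : H ⊗[k] H) : counit (R := k) (leftSlice F z) =
        F (TensorProduct.rid k H (counit.lTensor H z)) := by
      induction z with
      | zero => simp
      | tmul u v => simp [mul_comm]
      | add u v hu hv => simp only [map_add, hu, hv]
    rw [h1, mul_antipode_rTensor_comul_apply, hw, h2]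
    simp
  have hmem : b * ψ (comul w) ∈ K := by
    rw [← sum_basis_tmul_leftSlice (Module.finBasis k H) (comul w), map_sum, Finset.mul_sum]
    refine sum_mem fun i _ ↦ ?_
    rw [hw, leftSlice_comul_leftSlice_comul]
    have hc := hb.mul (isCoinvariant_of_mem hΔ hΛ (hSK _ (P (Module.finBasis k H i)).2))
    simpa [ψ, ← mul_assoc, hc.mul_leftSlice] using leftSlice_comul_mem hΔ hΛK _
  rw [hψ, ← Algebra.commutes, ← Algebra.smul_def] at hmem
  simpa [smul_smul, inv_mul_cancel₀ hF] using K.smul_mem hmem (F Λ)⁻¹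

end HopfSubalgebra

end HopfAlgebra


/-- Let `H` be a semisimple Hopf algebra over an algebraically closed field of
characteristic zero and `K` a Hopf subalgebra whose two-sided integral `Λ_K` is central in `H`.
Then `K` is a normal Hopf subalgebra: `a₍₁₎ K S(a₍₂₎) ⊆ K` for all `a ∈ H`. -/
theorem central_integral_implies_normal_hopf_subalgebra
    (k : Type*) [Field k] [IsAlgClosed k] [CharZero k]
    (H : Type*) [Ring H] [HopfAlgebra k H] [FiniteDimensional k H] [IsSemisimpleRing H]
    (K : Subalgebra k H)
    -- `K` is a Hopf subalgebra
    (hΔ : ∀ x ∈ K, comul (R := k) x ∈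
      LinearMap.range (TensorProduct.map K.val.toLinearMap K.val.toLinearMap))
    (hSK : ∀ x ∈ K, antipode (R := k) x ∈ K)
    -- `Λ` is a nonzero two-sided integral of `K`, fixed by the antipode
    (Λ : H) (hΛK : Λ ∈ K) (hΛ0 : Λ ≠ 0)
    (hΛl : ∀ x ∈ K, x * Λ = (counit (R := k) x : k) • Λ)
    (hΛr : ∀ x ∈ K, Λ * x = (counit (R := k) x : k) • Λ)
    (hSΛ : antipode (R := k) Λ = Λ)
    -- `Λ` is central in `H`
    (hcentral : ∀ a : H, a * Λ = Λ * a) :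
    ∀ a : H, ∀ x ∈ K,
      LinearMap.mul' k H
        ((TensorProduct.map (LinearMap.mulRight k x) (antipode (R := k)))
          (comul (R := k) a)) ∈ K := by
  intro a x hx
  exact HopfAlgebra.mem_of_isCoinvariant hΔ hSK hΛK hΛ0 hΛl
    (HopfAlgebra.isCoinvariant_adjoint hcentral
      (HopfAlgebra.isCoinvariant_of_mem hΔ hΛl hx) a)
end

section
/- For a semisimple Hopf algebra H over an algebraically closed field of characteristic zero and a Hopf subalgebra K: K is normal in H if and only if the integral Λ_K of K is central in H. -/
open TensorProduct Coalgebra HopfAlgebra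

theorem eq_zero_of_forall_mul_mul_eq_zero {R : Type*} [Ring R] [IsSemisimpleRing R] {x : R}
    (h : ∀ a, x * a * x = 0) : x = 0 := by
  obtain ⟨e, he, hI⟩ := IsSemisimpleRing.ideal_eq_span_idempotent (Ideal.span {x})
  obtain ⟨y, rfl⟩ := Ideal.mem_span_singleton'.1
    (hI ▸ Ideal.mem_span_singleton_self e : e ∈ Ideal.span {x})
  obtain ⟨z, hz⟩ := Ideal.mem_span_singleton'.1
    (hI ▸ Ideal.mem_span_singleton_self x : x ∈ Ideal.span {y * x})
  have h0 : y * x = 0 := by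
    rw [← he.eq, mul_assoc, ← mul_assoc x, h, mul_zero]
  rw [← hz, h0, mul_zero]

namespace HopfAlgebra

section CommRing

variable {k H : Type*} [CommRing k] [Ring H] [HopfAlgebra k H]

/-- The left adjoint action `x ↦ a₍₁₎ x S(a₍₂₎)` of `a`. -/
noncomputable def adjointAction (a : H) : H →ₗ[k] H where
  toFun x := LinearMap.mul' k H
    ((TensorProduct.map (LinearMap.mulRight k x) (antipode (R := k))) (comul (R := k) a))
  map_add' x y := by
    simp [← (ℛ k a).eq, mul_add, add_mul, Finset.sum_add_distrib]
  map_smul' c x := by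
    simp [← (ℛ k a).eq, Finset.smul_sum]

theorem adjointAction_apply (a x : H) {ι : Type*} (r : Repr k a ι) :
    adjointAction (k := k) a x = ∑ i ∈ r.index, r.left i * x * antipode k (r.right i) := by
  simp [adjointAction, ← r.eq]

theorem counit_adjointAction (a x : H) :
    counit (R := k) (adjointAction (k := k) a x) = counit (R := k) a * counit (R := k) x := by
  rw [adjointAction_apply a x (ℛ k a)]
  simp only [map_sum, Bialgebra.counit_mul, counit_antipode]
  conv_rhs => rw [← sum_counit_smul (ℛ k a)]
  simp only [map_sum, map_smul, smul_eq_mul, Finset.sum_mul]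
  exact Finset.sum_congr rfl fun i _ => by ring

theorem sum_counit_smul_right {a : H} {ι : Type*} (r : Repr k a ι) :
    ∑ i ∈ r.index, counit (R := k) (r.right i) • r.left i = a := by
  simpa only [map_sum, TensorProduct.rid_tmul, one_smul] using
    congrArg (TensorProduct.rid k H) (sum_tmul_counit_eq r)

theorem sum_adjointAction_mul (a x : H) {ι : Type*} (r : Repr k a ι) :
    ∑ i ∈ r.index, adjointAction (k := k) (r.left i) x * r.right i = a * x := by
  have h := congrArg (LinearMap.mul' k H ∘ₗ TensorProduct.map (LinearMap.mulRight k x)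
    (LinearMap.mul' k H ∘ₗ TensorProduct.map (antipode k) LinearMap.id))
    (sum_tmul_tmul_eq r (fun i => ℛ k (r.left i)) (fun i => ℛ k (r.right i)))
  simp only [map_sum, LinearMap.comp_apply, TensorProduct.map_tmul, LinearMap.mul'_apply,
    LinearMap.mulRight_apply, LinearMap.id_apply, ← Finset.mul_sum,
    sum_antipode_mul_eq_smul] at h
  simp only [adjointAction_apply _ x (ℛ k _), Finset.sum_mul, mul_assoc] at h ⊢
  rw [h]
  conv_rhs => rw [← sum_counit_smul_right r]
  simp [Finset.sum_mul]

theorem sum_antipode_tmul_one_mul_comul {a : H} {ι : Type*} (r : Repr k a ι) :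
    ∑ i ∈ r.index, (antipode k (r.left i) ⊗ₜ[k] (1 : H)) * comul (R := k) (r.right i) =
      1 ⊗ₜ[k] a := by
  have h := congrArg (TensorProduct.map
    (LinearMap.mul' k H ∘ₗ TensorProduct.map (antipode k) LinearMap.id) LinearMap.id ∘ₗ
      (TensorProduct.assoc k H H H).symm.toLinearMap)
    (sum_tmul_tmul_eq r (fun i => ℛ k (r.left i)) (fun i => ℛ k (r.right i)))
  simp only [map_sum, LinearMap.comp_apply, LinearEquiv.coe_coe, TensorProduct.assoc_symm_tmul,
    TensorProduct.map_tmul, LinearMap.mul'_apply, LinearMap.id_apply, ← TensorProduct.sum_tmul,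
    sum_antipode_mul_eq_smul] at h
  conv_lhs =>
    enter [2, i]
    rw [← (ℛ k (r.right i)).eq]
  simp only [Finset.mul_sum, Algebra.TensorProduct.tmul_mul_tmul, one_mul]
  rw [← h]
  simp only [TensorProduct.smul_tmul, ← TensorProduct.tmul_sum, sum_counit_smul]

theorem sum_comul_mul_one_tmul_antipode {a : H} {ι : Type*} (r : Repr k a ι) :
    ∑ i ∈ r.index, comul (R := k) (r.left i) * ((1 : H) ⊗ₜ[k] antipode k (r.right i)) =
      a ⊗ₜ[k] 1 := by
  have h := congrArg (TensorProduct.map LinearMap.id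
    (LinearMap.mul' k H ∘ₗ TensorProduct.map LinearMap.id (antipode k)))
    (sum_tmul_tmul_eq r (fun i => ℛ k (r.left i)) (fun i => ℛ k (r.right i)))
  simp only [map_sum, LinearMap.comp_apply,
    TensorProduct.map_tmul, LinearMap.mul'_apply, LinearMap.id_apply, ← TensorProduct.tmul_sum,
    sum_mul_antipode_eq_smul] at h
  conv_lhs =>
    enter [2, i]
    rw [← (ℛ k (r.left i)).eq]
  simp only [Finset.sum_mul, Algebra.TensorProduct.tmul_mul_tmul, mul_one]
  rw [h]
  simp only [← TensorProduct.smul_tmul, ← TensorProduct.sum_tmul, sum_counit_smul_right]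

/-- For `z` central, `z₍₁₎ ⊗ a₍₁₎ z₍₂₎ S(a₍₂₎) = S(a₍₁₎) z₍₁₎ a₍₂₎ ⊗ z₍₂₎`. -/
theorem sum_one_tmul_mul_comul_mul {z : H} (hz : ∀ a, a * z = z * a) {a : H} {ι : Type*}
    (r : Repr k a ι) :
    ∑ i ∈ r.index, ((1 : H) ⊗ₜ[k] r.left i) * comul (R := k) z *
        ((1 : H) ⊗ₜ[k] antipode k (r.right i)) =
      ∑ i ∈ r.index, (antipode k (r.left i) ⊗ₜ[k] (1 : H)) * comul (R := k) z *
        (r.right i ⊗ₜ[k] (1 : H)) := by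
  have h := congrArg (LinearMap.mul' k (H ⊗[k] H) ∘ₗ TensorProduct.map
      (LinearMap.mulRight k (comul (R := k) z) ∘ₗ
        (Algebra.TensorProduct.includeLeft : H →ₐ[k] H ⊗[k] H).toLinearMap ∘ₗ antipode k)
      (LinearMap.mul' k (H ⊗[k] H) ∘ₗ TensorProduct.map (comul (R := k))
        ((Algebra.TensorProduct.includeRight : H →ₐ[k] H ⊗[k] H).toLinearMap ∘ₗ antipode k)))
    (sum_tmul_tmul_eq r (fun i => ℛ k (r.left i)) (fun i => ℛ k (r.right i)))
  simp only [map_sum, LinearMap.comp_apply, TensorProduct.map_tmul, LinearMap.mul'_apply,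
    LinearMap.mulRight_apply, AlgHom.toLinearMap_apply, Algebra.TensorProduct.includeLeft_apply,
    Algebra.TensorProduct.includeRight_apply, ← Finset.mul_sum,
    sum_comul_mul_one_tmul_antipode] at h
  rw [← h]
  refine Finset.sum_congr rfl fun i _ => ?_
  rw [← sum_antipode_tmul_one_mul_comul (ℛ k (r.left i)), Finset.sum_mul, Finset.sum_mul]
  refine Finset.sum_congr rfl fun j _ => ?_
  rw [mul_assoc _ (comul _) (comul z), ← Bialgebra.comul_mul, hz, Bialgebra.comul_mul]
  simp only [mul_assoc]

/-- The contraction `u ⊗ v ↦ g(u) v`. -/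
noncomputable def contractLeft (g : H →ₗ[k] k) : H ⊗[k] H →ₗ[k] H :=
  (TensorProduct.lid k H).toLinearMap ∘ₗ g.rTensor H

@[simp]
theorem contractLeft_tmul (g : H →ₗ[k] k) (u v : H) :
    contractLeft g (u ⊗ₜ[k] v) = g u • v := by
  simp [contractLeft]

theorem contractLeft_one_tmul_mul_mul_one_tmul (g : H →ₗ[k] k) (a b : H) (t : H ⊗[k] H) :
    contractLeft g (((1 : H) ⊗ₜ[k] a) * t * ((1 : H) ⊗ₜ[k] b)) = a * contractLeft g t * b := by
  induction t with
  | zero => simp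
  | tmul u v => simp
  | add s t hs ht => simp only [mul_add, add_mul, map_add, hs, ht]

theorem contractLeft_one_tmul_mul (g : H →ₗ[k] k) (a : H) (t : H ⊗[k] H) :
    contractLeft g (((1 : H) ⊗ₜ[k] a) * t) = a * contractLeft g t := by
  simpa [← Algebra.TensorProduct.one_def] using contractLeft_one_tmul_mul_mul_one_tmul g a 1 t

theorem contractLeft_tmul_one_mul (g : H →ₗ[k] k) (a : H) (t : H ⊗[k] H) :
    contractLeft g ((a ⊗ₜ[k] (1 : H)) * t) = contractLeft (g ∘ₗ LinearMap.mulLeft k a) t := by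
  induction t with
  | zero => simp
  | tmul u v => simp
  | add s t hs ht => simp only [mul_add, map_add, hs, ht]

theorem contractLeft_mem {K : Subalgebra k H} {t : H ⊗[k] H}
    (ht : t ∈ LinearMap.range (TensorProduct.map K.val.toLinearMap K.val.toLinearMap))
    (g : H →ₗ[k] k) (a b : H) :
    contractLeft g ((a ⊗ₜ[k] (1 : H)) * t * (b ⊗ₜ[k] (1 : H))) ∈ K := by
  obtain ⟨s, rfl⟩ := ht
  induction s with
  | zero => simp
  | tmul u v => simpa using K.smul_mem v.2 _
  | add s t hs ht =>
    simp only [mul_add, add_mul, map_add]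
    exact K.add_mem hs ht

theorem sum_basis_tmul_contractLeft {ι : Type*} [Fintype ι] (b : Module.Basis ι k H)
    (t : H ⊗[k] H) : ∑ i, b i ⊗ₜ[k] contractLeft (b.coord i) t = t := by
  induction t with
  | zero => simp
  | tmul u v =>
    simp only [contractLeft_tmul, ← TensorProduct.smul_tmul, ← TensorProduct.sum_tmul,
      Module.Basis.coord_apply, b.sum_repr]
  | add s t hs ht => simp only [map_add, TensorProduct.tmul_add, Finset.sum_add_distrib, hs, ht]

/-- Contractions of the comultiplication of a central element of `K` are carried into `K` by the
adjoint action. -/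
theorem adjointAction_contractLeft_comul_mem {K : Subalgebra k H} {z : H}
    (hz : ∀ a, a * z = z * a)
    (hΔ : comul (R := k) z ∈
      LinearMap.range (TensorProduct.map K.val.toLinearMap K.val.toLinearMap))
    (a : H) (g : H →ₗ[k] k) :
    adjointAction (k := k) a (contractLeft g (comul (R := k) z)) ∈ K := by
  rw [adjointAction_apply a _ (ℛ k a)]
  simp only [← contractLeft_one_tmul_mul_mul_one_tmul]
  rw [← map_sum, sum_one_tmul_mul_comul_mul hz, map_sum]
  exact K.sum_mem fun i _ => contractLeft_mem hΔ g _ _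

/-- If `z` is a left integral of `K`, then `z₍₁₎ ⊗ x z₍₂₎ = S(x) z₍₁₎ ⊗ z₍₂₎` for `x ∈ K`. -/
theorem one_tmul_mul_comul {K : Subalgebra k H} {z : H}
    (hz : ∀ x ∈ K, x * z = (counit (R := k) x : k) • z) {x : H}
    (hΔ : comul (R := k) x ∈
      LinearMap.range (TensorProduct.map K.val.toLinearMap K.val.toLinearMap)) :
    ((1 : H) ⊗ₜ[k] x) * comul (R := k) z =
      (antipode k x ⊗ₜ[k] (1 : H)) * comul (R := k) z := by
  obtain ⟨t, ht⟩ := hΔ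
  obtain ⟨s, rfl⟩ := TensorProduct.exists_finset t
  let r : Repr k x (K × K) := ⟨s, fun p => p.1, fun p => p.2, by simpa using ht⟩
  rw [← sum_antipode_tmul_one_mul_comul r, Finset.sum_mul]
  conv_rhs => rw [← sum_counit_smul_right r]
  simp only [map_sum, map_smul, TensorProduct.sum_tmul, Finset.sum_mul]
  refine Finset.sum_congr rfl fun p _ => ?_
  rw [mul_assoc, ← Bialgebra.comul_mul, hz _ p.2.2, map_smul, mul_smul_comm,
    ← TensorProduct.smul_tmul', smul_mul_assoc]

end CommRing

section Field

variable {k H : Type*} [Field k] [Ring H] [HopfAlgebra k H]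

theorem adjointAction_mem_of_central [FiniteDimensional k H] {K : Subalgebra k H}
    (hΔ : ∀ x ∈ K, comul (R := k) x ∈
      LinearMap.range (TensorProduct.map K.val.toLinearMap K.val.toLinearMap))
    (hSK : ∀ x ∈ K, antipode (R := k) x ∈ K)
    {z : H} (hzK : z ∈ K) (hzl : ∀ x ∈ K, x * z = (counit (R := k) x : k) • z)
    (hε : counit (R := k) z ≠ 0) (hz : ∀ a, a * z = z * a) (a : H) {x : H} (hx : x ∈ K) :
    adjointAction (k := k) a x ∈ K := by
  obtain ⟨p, hp⟩ := K.val.toLinearMap.exists_leftInverse_of_injective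
    (LinearMap.ker_eq_bot.2 Subtype.val_injective)
  have hp' (u : K) : p u = u := LinearMap.congr_fun hp u
  have hpz : (K.val.toLinearMap ∘ₗ p).rTensor H (comul (R := k) z) = comul (R := k) z := by
    obtain ⟨t, ht⟩ := hΔ z hzK
    rw [← ht]
    clear ht
    induction t with
    | zero => simp
    | tmul u v => simp [hp']
    | add s t hs ht => simp only [map_add, hs, ht]
  have key : counit (R := k) z • x = LinearMap.mul' k H
      (TensorProduct.map (LinearMap.mulLeft k x ∘ₗ antipode k) LinearMap.id
        (comul (R := k) z)) := by
    rw [← (ℛ k z).eq]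
    simp [mul_assoc, ← Finset.mul_sum, sum_antipode_mul_eq_smul]
  let b := Module.finBasis k H
  have hmem : adjointAction (k := k) a (counit (R := k) z • x) ∈ K := by
    rw [key, ← hpz]
    conv in comul z => rw [← sum_basis_tmul_contractLeft b (comul (R := k) z)]
    simp only [map_sum, LinearMap.rTensor_tmul, TensorProduct.map_tmul, LinearMap.mul'_apply,
      LinearMap.comp_apply, LinearMap.mulLeft_apply, LinearMap.id_apply]
    refine K.sum_mem fun i _ => ?_
    have hy := K.mul_mem hx (hSK _ (p (b i)).2)
    rw [AlgHom.toLinearMap_apply, Subalgebra.val_apply, ← contractLeft_one_tmul_mul,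
      one_tmul_mul_comul hzl (hΔ _ hy), contractLeft_tmul_one_mul]
    exact adjointAction_contractLeft_comul_mem hz (hΔ z hzK) a _
  rw [map_smul] at hmem
  simpa [smul_smul, hε] using K.smul_mem hmem (counit (R := k) z)⁻¹

theorem central_of_adjointAction_mem [IsSemisimpleRing H] {K : Subalgebra k H}
    {z : H} (hzK : z ∈ K) (hz0 : z ≠ 0)
    (hzl : ∀ x ∈ K, x * z = (counit (R := k) x : k) • z)
    (hzr : ∀ x ∈ K, z * x = (counit (R := k) x : k) • z)
    (hK : ∀ a, ∀ x ∈ K, adjointAction (k := k) a x ∈ K) (a : H) : a * z = z * a := by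
  have hzaz (a : H) : z * a * z = counit (R := k) z • (z * a) := by
    rw [mul_assoc, ← sum_adjointAction_mul (k := k) a z (ℛ k a), Finset.mul_sum]
    conv_rhs => rw [← sum_counit_smul (ℛ k a)]
    rw [Finset.mul_sum, Finset.smul_sum]
    refine Finset.sum_congr rfl fun i _ => ?_
    rw [← mul_assoc, hzr _ (hK _ z hzK), counit_adjointAction, mul_smul_comm, smul_mul_assoc,
      smul_smul, mul_comm]
  have hε : counit (R := k) z ≠ 0 := fun h0 =>
    hz0 (eq_zero_of_forall_mul_mul_eq_zero fun a => by rw [hzaz, h0, zero_smul])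
  have hzz : z * z = counit (R := k) z • z := hzl z hzK
  have hzd : z * (a * z - z * a) = 0 := by
    rw [mul_sub, ← mul_assoc, ← mul_assoc, hzaz, hzz, smul_mul_assoc, sub_self]
  have hdz : (a * z - z * a) * z = counit (R := k) z • (a * z - z * a) := by
    rw [sub_mul, hzaz, mul_assoc, hzz, mul_smul_comm, smul_sub]
  refine sub_eq_zero.1 (eq_zero_of_forall_mul_mul_eq_zero fun h => ?_)
  generalize a * z - z * a = d at hzd hdz
  have h2 : counit (R := k) z • counit (R := k) z • (d * h * d) = 0 := by
    calc counit (R := k) z • counit (R := k) z • (d * h * d)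
        = d * (counit (R := k) z • (z * h)) * d := by
          rw [mul_smul_comm, ← mul_assoc, hdz]
          simp only [smul_mul_assoc]
      _ = d * (z * h) * (z * d) := by
          rw [← hzaz]
          simp only [mul_assoc]
      _ = 0 := by rw [hzd, mul_zero]
  simpa [hε] using h2

end Field

end HopfAlgebra

/-- For a semisimple Hopf algebra `H` over an algebraically closed field of
characteristic zero and a Hopf subalgebra `K`: `K` is normal in `H` (i.e.
`a₍₁₎ K S(a₍₂₎) ⊆ K` for all `a ∈ H`) if and only if the two-sided integral `Λ_K` of `K` is
central in `H`. -/
theorem normal_iff_integral_central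
    (k : Type*) [Field k] [IsAlgClosed k] [CharZero k]
    (H : Type*) [Ring H] [HopfAlgebra k H] [FiniteDimensional k H] [IsSemisimpleRing H]
    (K : Subalgebra k H)
    -- `K` is a Hopf subalgebra
    (hΔ : ∀ x ∈ K, comul (R := k) x ∈
      LinearMap.range (TensorProduct.map K.val.toLinearMap K.val.toLinearMap))
    (hSK : ∀ x ∈ K, antipode (R := k) x ∈ K)
    -- `Λ` is a nonzero two-sided integral of `K`, fixed by the antipode
    (Λ : H) (hΛK : Λ ∈ K) (hΛ0 : Λ ≠ 0)
    (hΛl : ∀ x ∈ K, x * Λ = (counit (R := k) x : k) • Λ)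
    (hΛr : ∀ x ∈ K, Λ * x = (counit (R := k) x : k) • Λ)
    (hSΛ : antipode (R := k) Λ = Λ) :
    (∀ a : H, ∀ x ∈ K,
      LinearMap.mul' k H
        ((TensorProduct.map (LinearMap.mulRight k x) (antipode (R := k)))
          (comul (R := k) a)) ∈ K)
    ↔ (∀ a : H, a * Λ = Λ * a) := by
  have hε_of_central (hc : ∀ a : H, a * Λ = Λ * a) : counit (R := k) Λ ≠ 0 := fun h0 =>
    hΛ0 (eq_zero_of_forall_mul_mul_eq_zero fun a => by
      rw [mul_assoc, hc a, ← mul_assoc, hΛl Λ hΛK, h0, zero_smul, zero_mul])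
  exact ⟨fun hK => central_of_adjointAction_mem hΛK hΛ0 hΛl hΛr hK, fun hc a x hx =>
    adjointAction_mem_of_central hΔ hSK hΛK hΛl (hε_of_central hc) hc a hx⟩
end
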